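/- Fix θ ∈ (0, π/2] and set a = (cos(θ/2), sin(θ/2), 0), b = (cos(θ/2), -sin(θ/2), 0) in ℝ³; X = {+a,−a,+b,−b}; ε(±a) = (1/8)(I ± a·σ), ε(±b) = (1/8)(I ± b·σ). Let T be the collection of all two-element subsets of X. Consider POVMs M̄ indexed by all functions φ : T → X (each M̄(φ) positive semidefinite 2×2 complex, Σ_φ M̄(φ) = I), with guessing probability E(M̄) = Σ_{x∈X} (1/3) Σ_{S∈T, x∉S} Σ_{φ : φ(S)=x} tr(ε(x) M̄(φ)). Then E(M̄) ≤ (6 + √(10+6cos θ))/12 for every such POVM. Moreover, letting n = (3a+b)/√(10+6cos θ) and, for j ∈ {+,−}, φ_j : T → X the function with φ_j(S) = j·a if j·a ∉ S, φ_j(S) = j·b if j·a ∈ S and j·b ∉ S, and φ_j(S) = −j·b if both j·a ∈ S and j·b ∈ S, the assignment M̄(φ_j) = (1/2)(I + j·n·σ) and M̄(φ) = 0 for φ ∉ {φ₊, φ₋} defines a POVM attaining E(M̄) = (6 + √(10+6cos θ))/12. -/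

import Mathlib

open Matrix
open scoped ComplexOrder

open Matrix

/-- For `v = (v₁, v₂, v₃) ∈ ℝ³`, the matrix `v·σ = v₁σ₁ + v₂σ₂ + v₃σ₃` where
`σ₁, σ₂, σ₃` are the Pauli matrices. -/
noncomputable def pauli (v : Fin 3 → ℝ) : Matrix (Fin 2) (Fin 2) ℂ :=
  (v 0 : ℂ) • !![0, 1; 1, 0] + (v 1 : ℂ) • !![0, -Complex.I; Complex.I, 0] +
    (v 2 : ℂ) • !![1, 0; 0, -1]

/-- The Bloch vector `a = (cos(θ/2), sin(θ/2), 0)`. -/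
noncomputable def aVec (θ : ℝ) : Fin 3 → ℝ := ![Real.cos (θ/2), Real.sin (θ/2), 0]

/-- The Bloch vector `b = (cos(θ/2), -sin(θ/2), 0)`. -/
noncomputable def bVec (θ : ℝ) : Fin 3 → ℝ := ![Real.cos (θ/2), -Real.sin (θ/2), 0]

/-- The four inputs `X = {+a, -a, +b, -b}`, indexed as `0 ↦ +a`, `1 ↦ -a`, `2 ↦ +b`,
`3 ↦ -b`. -/
noncomputable def vecX (θ : ℝ) : Fin 4 → Fin 3 → ℝ := ![aVec θ, -aVec θ, bVec θ, -bVec θ]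

/-- The state ensemble `ε(±a) = (1/8)(I ± a·σ)`, `ε(±b) = (1/8)(I ± b·σ)`. -/
noncomputable def eps (θ : ℝ) (x : Fin 4) : Matrix (Fin 2) (Fin 2) ℂ :=
  (1/8 : ℂ) • (1 + pauli (vecX θ x))


/-- The Bloch vector `n = (3a + b)/√(10 + 6 cos θ)`. -/
noncomputable def nVec (θ : ℝ) : Fin 3 → ℝ :=
  (Real.sqrt (10 + 6 * Real.cos θ))⁻¹ • ((3 : ℝ) • aVec θ + bVec θ)

/-- `T`: the collection of all two-element subsets of `X` (with `X` indexed by `Fin 4`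
as `0 ↦ +a`, `1 ↦ -a`, `2 ↦ +b`, `3 ↦ -b`). -/
def TwoSet : Type := {S : Finset (Fin 4) // S.card = 2}

instance : Fintype TwoSet := Subtype.fintype _

instance : DecidableEq TwoSet := Subtype.instDecidableEq

/-- `φ₊ : T → X` with `φ₊(S) = +a` if `+a ∉ S`, `φ₊(S) = +b` if `+a ∈ S` and `+b ∉ S`,
and `φ₊(S) = -b` if both `+a ∈ S` and `+b ∈ S`. -/
def phiPlus : TwoSet → Fin 4 := fun S =>
  if 0 ∉ S.val then 0 else if 2 ∉ S.val then 2 else 3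

/-- `φ₋ : T → X` with `φ₋(S) = -a` if `-a ∉ S`, `φ₋(S) = -b` if `-a ∈ S` and `-b ∉ S`,
and `φ₋(S) = +b` if both `-a ∈ S` and `-b ∈ S`. -/
def phiMinus : TwoSet → Fin 4 := fun S =>
  if 1 ∉ S.val then 1 else if 3 ∉ S.val then 3 else 2

/-- The optimal measurement `M̄` of Theorem 1 with `k = 2`:
`M̄(φ_j) = (1/2)(I + j n·σ)` and `M̄(φ) = 0` otherwise. -/
noncomputable def MbarTwo (θ : ℝ) (φ : TwoSet → Fin 4) : Matrix (Fin 2) (Fin 2) ℂ :=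
  if φ = phiPlus then (1/2 : ℂ) • (1 + pauli (nVec θ))
  else if φ = phiMinus then (1/2 : ℂ) • (1 - pauli (nVec θ))
  else 0

/-- Bloch coordinates of a positive semidefinite `2 × 2` matrix. -/
lemma exists_bloch_of_posSemidef {M : Matrix (Fin 2) (Fin 2) ℂ} (hM : M.PosSemidef) :
    ∃ t p q r : ℝ, 0 ≤ t ∧ p ^ 2 + q ^ 2 + r ^ 2 ≤ t ^ 2 ∧ M.trace = (t : ℂ) ∧
      ∀ v : Fin 3 → ℝ, ((1 + pauli v) * M).trace = ((t + v 0 * p + v 1 * q + v 2 * r : ℝ) : ℂ) := by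
  have h00 := hM.diag_nonneg (i := 0)
  have h11 := hM.diag_nonneg (i := 1)
  have h10 : M 1 0 = star (M 0 1) := (hM.isHermitian.apply 1 0).symm
  have hdet := hM.det_nonneg
  rw [Matrix.det_fin_two, h10] at hdet
  rw [Complex.nonneg_iff] at h00 h11 hdet
  obtain ⟨h0, h0'⟩ := h00
  obtain ⟨h1, h1'⟩ := h11
  obtain ⟨hd, -⟩ := hdet
  simp [← h0', ← h1'] at hd
  refine ⟨(M 0 0).re + (M 1 1).re, 2 * (M 0 1).re, -2 * (M 0 1).im, (M 0 0).re - (M 1 1).re,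
    by positivity, by nlinarith, ?_, fun v => ?_⟩
  · rw [Matrix.trace_fin_two]
    apply Complex.ext <;> simp [← h0', ← h1']
  · rw [Matrix.trace_fin_two]
    apply Complex.ext <;>
      simp [pauli, Matrix.mul_apply, Fin.sum_univ_two, h10, ← h0', ← h1'] <;> ring

/-- The two-element subset `{i, j}` of the four inputs. -/
def TwoSet.pair (i j : Fin 4) (h : i ≠ j) : TwoSet := ⟨{i, j}, Finset.card_pair h⟩

@[simp]
lemma TwoSet.mem_pair {x i j : Fin 4} (h : i ≠ j) :
    x ∈ (TwoSet.pair i j h).val ↔ x = i ∨ x = j := by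
  simp [TwoSet.pair]

lemma TwoSet.sum_univ {A : Type*} [AddCommMonoid A] (f : TwoSet → A) :
    ∑ S, f S = f (pair 0 1 (by decide)) + (f (pair 0 2 (by decide)) +
      (f (pair 0 3 (by decide)) + (f (pair 1 2 (by decide)) +
        (f (pair 1 3 (by decide)) + f (pair 2 3 (by decide)))))) := by
  have h : (Finset.univ : Finset TwoSet) = {pair 0 1 (by decide), pair 0 2 (by decide),
      pair 0 3 (by decide), pair 1 2 (by decide), pair 1 3 (by decide),
      pair 2 3 (by decide)} := by
    decide
  rw [h, Finset.sum_insert, Finset.sum_insert, Finset.sum_insert, Finset.sum_insert,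
    Finset.sum_insert, Finset.sum_singleton] <;> decide

/-- A score summed over correct guesses, regrouped by post-processing function. -/
lemma sum_guess_eq_sum_postprocessing (f : Fin 4 → (TwoSet → Fin 4) → ℂ) :
    (∑ x : Fin 4, (1/3 : ℂ) *
      ∑ S ∈ Finset.univ.filter (fun S : TwoSet => x ∉ S.val),
        ∑ φ ∈ Finset.univ.filter (fun φ : TwoSet → Fin 4 => φ S = x), f x φ) =
    (1/3 : ℂ) * ∑ φ : TwoSet → Fin 4, ∑ S : TwoSet, if φ S ∉ S.val then f (φ S) φ else 0 := by
  rw [← Finset.mul_sum]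
  congr 1
  simp only [Finset.sum_filter]
  calc _ = ∑ x : Fin 4, ∑ S : TwoSet, ∑ φ : TwoSet → Fin 4,
        (if φ S = x then if φ S ∉ S.val then f (φ S) φ else 0 else 0) := by
        refine Finset.sum_congr rfl fun x _ => Finset.sum_congr rfl fun S _ => ?_
        by_cases h : x ∈ S.val
        · rw [if_neg (not_not.2 h)]
          refine (Finset.sum_eq_zero fun φ _ => ?_).symm
          by_cases hx : φ S = x
          · rw [if_pos hx, hx, if_neg (not_not.2 h)]
          · rw [if_neg hx]
        · rw [if_pos h]
          refine Finset.sum_congr rfl fun φ _ => ?_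
          by_cases hx : φ S = x
          · rw [if_pos hx, if_pos hx, hx, if_pos h]
          · rw [if_neg hx, if_neg hx]
    _ = ∑ S : TwoSet, ∑ φ : TwoSet → Fin 4, ∑ x : Fin 4,
        (if φ S = x then if φ S ∉ S.val then f (φ S) φ else 0 else 0) := by
        rw [Finset.sum_comm]
        exact Finset.sum_congr rfl fun S _ => Finset.sum_comm
    _ = _ := by
        rw [Finset.sum_comm]
        simp only [Finset.sum_ite_eq, Finset.mem_univ, if_true]

lemma sum_correct_le_max (u : Fin 4 → ℝ) (hu : ∀ x, 0 ≤ u x) (φ : TwoSet → Fin 4) :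
    (∑ S : TwoSet, if φ S ∉ S.val then u (φ S) else 0) ≤
      max (u 2) (u 3) + (max (u 1) (u 3) + (max (u 1) (u 2) +
        (max (u 0) (u 3) + (max (u 0) (u 2) + max (u 0) (u 1))))) := by
  have key : ∀ (S : TwoSet) (i j : Fin 4), (∀ y, y ∉ S.val → y = i ∨ y = j) →
      (if φ S ∉ S.val then u (φ S) else 0) ≤ max (u i) (u j) := fun S i j h => by
    by_cases hS : φ S ∈ S.val
    · rw [if_neg (not_not.2 hS)]
      exact le_max_of_le_left (hu i)
    · rw [if_pos hS]
      rcases h _ hS with h | h <;> simp [h]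
  rw [TwoSet.sum_univ]
  refine add_le_add ?_ (add_le_add ?_ (add_le_add ?_ (add_le_add ?_ (add_le_add ?_ ?_)))) <;>
    exact key _ _ _ (by decide)

lemma mul_add_mul_le_mul {x y p q ρ t : ℝ} (hρ : 0 ≤ ρ) (ht : 0 ≤ t)
    (hxy : x ^ 2 + y ^ 2 ≤ ρ ^ 2) (hpq : p ^ 2 + q ^ 2 ≤ t ^ 2) : x * p + y * q ≤ ρ * t := by
  refine (le_abs_self _).trans (abs_le_of_sq_le_sq ?_ (mul_nonneg hρ ht))
  have h := mul_le_mul hxy hpq (by positivity) (by positivity)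
  nlinarith [sq_nonneg (x * q - y * p)]

lemma trace_eps_mul (θ : ℝ) (x : Fin 4) (M : Matrix (Fin 2) (Fin 2) ℂ) :
    (eps θ x * M).trace = (1/8 : ℂ) * ((1 + pauli (vecX θ x)) * M).trace := by
  rw [eps, Matrix.smul_mul, Matrix.trace_smul, smul_eq_mul]

lemma exists_sum_correct_eq_le {θ R : ℝ} (hR : 0 ≤ R) (hR2 : R ^ 2 = 10 + 6 * Real.cos θ)
    (hθ : 0 ≤ Real.cos θ) {M : Matrix (Fin 2) (Fin 2) ℂ} (hM : M.PosSemidef)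
    (φ : TwoSet → Fin 4) :
    ∃ e t : ℝ, M.trace = (t : ℂ) ∧
      (∑ S : TwoSet, if φ S ∉ S.val then (eps θ (φ S) * M).trace else 0) = (e : ℂ) ∧
      e ≤ (6 + R) / 8 * t := by
  obtain ⟨t, p, q, r, ht, hpqr, htr, hv⟩ := exists_bloch_of_posSemidef hM
  have hpq : p ^ 2 + q ^ 2 ≤ t ^ 2 := by nlinarith [sq_nonneg r]
  set c := Real.cos (θ / 2) with hc
  set s := Real.sin (θ / 2) with hs
  have hcs : s ^ 2 + c ^ 2 = 1 := Real.sin_sq_add_cos_sq _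
  have hcos : Real.cos θ = 2 * c ^ 2 - 1 := by
    rw [hc, ← Real.cos_two_mul]
    ring_nf
  let u : Fin 4 → ℝ := ![t + (c * p + s * q), t - (c * p + s * q),
    t + (c * p - s * q), t - (c * p - s * q)]
  have hε : ∀ x, (eps θ x * M).trace = ((1 / 8 * u x : ℝ) : ℂ) := fun x => by
    rw [trace_eps_mul, hv]
    norm_cast
    push_cast
    fin_cases x <;> simp [vecX, aVec, bVec, u, ← hc, ← hs] <;> ring
  have hu : ∀ x, 0 ≤ u x := fun x => by
    have key : ∀ x y, x ^ 2 + y ^ 2 ≤ 1 ^ 2 → x * p + y * q ≤ 1 * t := fun x y h =>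
      mul_add_mul_le_mul zero_le_one ht h hpq
    have h1 := key c s (by linarith)
    have h2 := key (-c) (-s) (by linarith)
    have h3 := key c (-s) (by linarith)
    have h4 := key (-c) s (by linarith)
    fin_cases x <;> simp [u] <;> linarith
  refine ⟨1 / 8 * ∑ S : TwoSet, (if φ S ∉ S.val then u (φ S) else 0), t, htr, ?_, ?_⟩
  · simp only [hε]
    push_cast
    rw [Finset.mul_sum]
    refine Finset.sum_congr rfl fun S _ => ?_
    split_ifs <;> simp
  · have key : ∀ x y, x ^ 2 + y ^ 2 ≤ R ^ 2 → x * p + y * q ≤ R * t := fun x y h =>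
      mul_add_mul_le_mul hR ht h hpq
    have h1 := key (4 * c) (2 * s) (by linarith)
    have h2 := key (4 * c) (-2 * s) (by linarith)
    have h3 := key (-4 * c) (2 * s) (by linarith)
    have h4 := key (-4 * c) (-2 * s) (by linarith)
    have h5 := key (2 * c) (4 * s) (by linarith)
    have h6 := key (2 * c) (-4 * s) (by linarith)
    have h7 := key (-2 * c) (4 * s) (by linarith)
    have h8 := key (-2 * c) (-4 * s) (by linarith)
    have hmax := sum_correct_le_max u hu φ
    suffices h : max (u 2) (u 3) + (max (u 1) (u 3) + (max (u 1) (u 2) +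
        (max (u 0) (u 3) + (max (u 0) (u 2) + max (u 0) (u 1))))) ≤ (6 + R) * t by linarith
    simp only [u, Matrix.cons_val, max_def]
    split_ifs <;> linarith

lemma trace_one_add_pauli_mul (v w : Fin 3 → ℝ) :
    ((1 + pauli v) * (1 + pauli w)).trace =
      ((2 * (1 + v 0 * w 0 + v 1 * w 1 + v 2 * w 2) : ℝ) : ℂ) := by
  rw [Matrix.trace_fin_two]
  apply Complex.ext <;> simp [pauli, Matrix.mul_apply, Fin.sum_univ_two] <;> ring

lemma posSemidef_half_one_add_pauli {v : Fin 3 → ℝ} (hv : v 0 ^ 2 + v 1 ^ 2 + v 2 ^ 2 = 1) :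
    ((1/2 : ℂ) • (1 + pauli v)).PosSemidef := by
  have h : ((1/2 : ℂ) • (1 + pauli v)) * ((1/2 : ℂ) • (1 + pauli v))ᴴ =
      (1/2 : ℂ) • (1 + pauli v) := by
    ext i j
    fin_cases i <;> fin_cases j <;> apply Complex.ext <;>
      simp [pauli, Matrix.mul_apply, Fin.sum_univ_two] <;> linarith
  rw [← h]
  exact Matrix.posSemidef_self_mul_conjTranspose _

lemma pauli_neg (v : Fin 3 → ℝ) : pauli (-v) = -pauli v := by
  ext i j
  fin_cases i <;> fin_cases j <;> simp [pauli] <;> ring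

lemma phiPlus_ne_phiMinus : phiPlus ≠ phiMinus := fun h =>
  absurd (congrFun h ⟨{2, 3}, by decide⟩) (by decide)

lemma MbarTwo_phiPlus (θ : ℝ) : MbarTwo θ phiPlus = (1/2 : ℂ) • (1 + pauli (nVec θ)) := by
  simp [MbarTwo]

lemma MbarTwo_phiMinus (θ : ℝ) : MbarTwo θ phiMinus = (1/2 : ℂ) • (1 + pauli (-nVec θ)) := by
  simp [MbarTwo, phiPlus_ne_phiMinus.symm, pauli_neg, sub_eq_add_neg]

lemma MbarTwo_eq_zero (θ : ℝ) {φ : TwoSet → Fin 4} (h : φ ≠ phiPlus ∧ φ ≠ phiMinus) :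
    MbarTwo θ φ = 0 := by
  simp [MbarTwo, h.1, h.2]

lemma trace_eps_mul_half_one_add_pauli (θ : ℝ) (x : Fin 4) (v : Fin 3 → ℝ) :
    (eps θ x * ((1/2 : ℂ) • (1 + pauli v))).trace =
      ((1 / 8 * (1 + vecX θ x 0 * v 0 + vecX θ x 1 * v 1 + vecX θ x 2 * v 2) : ℝ) : ℂ) := by
  rw [trace_eps_mul, Matrix.mul_smul, Matrix.trace_smul, trace_one_add_pauli_mul, smul_eq_mul]
  push_cast
  ring

theorem guessing_game_two_exclusions_optimum (θ : ℝ) (hθ : θ ∈ Set.Ioc 0 (Real.pi / 2)) :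
    (∀ Mbar : (TwoSet → Fin 4) → Matrix (Fin 2) (Fin 2) ℂ,
      (∀ φ, (Mbar φ).PosSemidef) → (∑ φ : TwoSet → Fin 4, Mbar φ) = 1 →
      (∑ x : Fin 4, (1/3 : ℂ) *
          ∑ S ∈ Finset.univ.filter (fun S : TwoSet => x ∉ S.val),
            ∑ φ ∈ Finset.univ.filter (fun φ : TwoSet → Fin 4 => φ S = x),
              (eps θ x * Mbar φ).trace) ≤
        (((6 + Real.sqrt (10 + 6 * Real.cos θ)) / 12 : ℝ) : ℂ)) ∧
    (∀ φ, (MbarTwo θ φ).PosSemidef) ∧ (∑ φ : TwoSet → Fin 4, MbarTwo θ φ) = 1 ∧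
    (∑ x : Fin 4, (1/3 : ℂ) *
        ∑ S ∈ Finset.univ.filter (fun S : TwoSet => x ∉ S.val),
          ∑ φ ∈ Finset.univ.filter (fun φ : TwoSet → Fin 4 => φ S = x),
            (eps θ x * MbarTwo θ φ).trace) =
      (((6 + Real.sqrt (10 + 6 * Real.cos θ)) / 12 : ℝ) : ℂ) := by
  obtain ⟨h0, h1⟩ := hθ
  have hcos : 0 ≤ Real.cos θ := Real.cos_nonneg_of_mem_Icc ⟨by linarith, h1⟩
  set R := Real.sqrt (10 + 6 * Real.cos θ) with hRdef
  have hRpos : 0 < R := Real.sqrt_pos.2 (by linarith)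
  have hR2 : R ^ 2 = 10 + 6 * Real.cos θ := Real.sq_sqrt (by linarith)
  have hcs : Real.sin (θ / 2) ^ 2 + Real.cos (θ / 2) ^ 2 = 1 := Real.sin_sq_add_cos_sq _
  have hR2' : R ^ 2 = 16 * Real.cos (θ / 2) ^ 2 + 4 * Real.sin (θ / 2) ^ 2 := by
    have : Real.cos θ = 2 * Real.cos (θ / 2) ^ 2 - 1 := by
      rw [← Real.cos_two_mul]
      ring_nf
    linarith
  have hn0 : nVec θ 0 = 4 * Real.cos (θ / 2) / R := by
    simp [nVec, aVec, bVec, ← hRdef]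
    ring
  have hn1 : nVec θ 1 = 2 * Real.sin (θ / 2) / R := by
    simp [nVec, aVec, bVec, ← hRdef]
    ring
  have hn2 : nVec θ 2 = 0 := by simp [nVec, aVec, bVec]
  have hn : nVec θ 0 ^ 2 + nVec θ 1 ^ 2 + nVec θ 2 ^ 2 = 1 := by
    rw [hn0, hn1, hn2]
    field_simp
    linarith
  refine ⟨fun Mbar hM hsum => ?_, fun φ => ?_, ?_, ?_⟩
  · rw [sum_guess_eq_sum_postprocessing fun x φ => (eps θ x * Mbar φ).trace]
    choose e t ht he hle using fun φ => exists_sum_correct_eq_le hRpos.le hR2 hcos (hM φ) φ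
    have htsum : ∑ φ, t φ = 2 := by
      have h := congrArg Matrix.trace hsum
      rw [Matrix.trace_sum, Matrix.trace_one] at h
      simp only [ht] at h
      rw [Fintype.card_fin] at h
      exact_mod_cast h
    simp only [he]
    have hesum : ∑ φ, e φ ≤ (6 + R) / 8 * 2 := by
      rw [← htsum, Finset.mul_sum]
      exact Finset.sum_le_sum fun φ _ => hle φ
    have h : 1 / 3 * ∑ φ, e φ ≤ (6 + R) / 12 := by linarith
    have hC := Complex.real_le_real.2 h
    push_cast at hC ⊢
    exact hC
  · by_cases hp : φ = phiPlus
    · rw [hp, MbarTwo_phiPlus]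
      exact posSemidef_half_one_add_pauli hn
    by_cases hm : φ = phiMinus
    · rw [hm, MbarTwo_phiMinus]
      exact posSemidef_half_one_add_pauli (by simpa using hn)
    rw [MbarTwo_eq_zero θ ⟨hp, hm⟩]
    exact Matrix.PosSemidef.zero
  · rw [Fintype.sum_eq_add _ _ phiPlus_ne_phiMinus fun φ h => MbarTwo_eq_zero θ h,
      MbarTwo_phiPlus, MbarTwo_phiMinus, pauli_neg, ← smul_add, add_add_add_comm,
      add_neg_cancel, add_zero, ← two_smul ℂ, smul_smul]
    norm_num
  · rw [sum_guess_eq_sum_postprocessing fun x φ => (eps θ x * MbarTwo θ φ).trace,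
      Fintype.sum_eq_add _ _ phiPlus_ne_phiMinus fun φ h => by simp [MbarTwo_eq_zero θ h],
      MbarTwo_phiPlus, MbarTwo_phiMinus, TwoSet.sum_univ, TwoSet.sum_univ]
    simp only [trace_eps_mul_half_one_add_pauli, phiPlus, phiMinus]
    simp [vecX, aVec, bVec, hn0, hn1, hn2]
    have hRC : (R : ℂ) ≠ 0 := by exact_mod_cast hRpos.ne'
    have hRC2 : (R : ℂ) ^ 2 = 16 * Complex.cos (θ / 2) ^ 2 + 4 * Complex.sin (θ / 2) ^ 2 := by
      exact_mod_cast congrArg ((↑) : ℝ → ℂ) hR2'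
    field_simp
    linear_combination -24 * hRC2
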